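/- (Corollary 1.) Let L be the Laplacian of a weight-balanced weighted digraph on N vertices with weights wᵢⱼ and out-degrees dᵢ > 0. For each i let σᵢ ∈ (0,1), and set φᵢ = Σⱼ wᵢⱼ(x̂ᵢ − x̂ⱼ)². If x̂, e ∈ ℝᴺ satisfy eᵢ² ≤ (σᵢ/(4dᵢ)) φᵢ for every i, then −x̂ᵀ L x̂ + eᵀ L x̂ ≤ −Σ_{i=1}^N ((1 − σᵢ)/4) φᵢ. -/

import Mathlib

open Matrix Finset

/-- The out-degree Laplacian acts by weighted differences. -/
lemma laplacian_mulVec_apply {ι : Type*} [Fintype ι] [DecidableEq ι]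
    (W : Matrix ι ι ℝ) (x : ι → ℝ) (i : ι) :
    ((Matrix.diagonal (fun i => ∑ k, W i k) - W).mulVec x) i =
      ∑ j, W i j * (x i - x j) := by
  rw [Matrix.sub_mulVec, Pi.sub_apply, Matrix.mulVec_diagonal, Finset.sum_mul]
  simp only [Matrix.mulVec, dotProduct, mul_sub, Finset.sum_sub_distrib]

/-- On a weight-balanced digraph, the quadratic form of the Laplacian is half the sum of the
weighted squared differences. -/
lemma sum_mul_sum_sub_of_balanced {ι : Type*} [Fintype ι]
    (W : Matrix ι ι ℝ) (hbal : ∀ i, ∑ j, W i j = ∑ j, W j i) (x : ι → ℝ) :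
    ∑ i, x i * ∑ j, W i j * (x i - x j) =
      1 / 2 * ∑ i, ∑ j, W i j * (x i - x j) ^ 2 := by
  have hsq : ∑ i, ∑ j, W i j * x j ^ 2 = ∑ i, ∑ j, W i j * x i ^ 2 := by
    rw [Finset.sum_comm]
    simp only [← Finset.sum_mul, hbal]
  have hsplit : ∑ i, ∑ j, W i j * (x i - x j) ^ 2 =
      2 * ∑ i, x i * ∑ j, W i j * (x i - x j) +
        (∑ i, ∑ j, W i j * x j ^ 2 - ∑ i, ∑ j, W i j * x i ^ 2) := by
    simp only [Finset.mul_sum, ← Finset.sum_sub_distrib, ← Finset.sum_add_distrib]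
    refine Finset.sum_congr rfl fun i _ => Finset.sum_congr rfl fun j _ => ?_
    ring
  rw [hsplit, hsq]
  ring

/-- Weighted Young inequality for a constant against a family of reals. -/
lemma mul_sum_mul_le_sum_mul_sq_add {ι : Type*} [Fintype ι] (w y : ι → ℝ)
    (hw : ∀ j, 0 ≤ w j) (c : ℝ) :
    c * ∑ j, w j * y j ≤ (∑ j, w j) * c ^ 2 + 1 / 4 * ∑ j, w j * y j ^ 2 := by
  rw [Finset.mul_sum, Finset.sum_mul, Finset.mul_sum, ← Finset.sum_add_distrib]
  refine Finset.sum_le_sum fun j _ => ?_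
  nlinarith [mul_nonneg (hw j) (sq_nonneg (c - y j / 2))]

/-- Corollary 1: for a weight-balanced digraph with Laplacian `L`,
out-degrees `dᵢ > 0`, parameters `σᵢ ∈ (0,1)`, and `φᵢ = ∑ⱼ wᵢⱼ(x̂ᵢ - x̂ⱼ)²`, if
`eᵢ² ≤ (σᵢ/(4dᵢ)) φᵢ` for every `i`, then
`-x̂ᵀ L x̂ + eᵀ L x̂ ≤ -∑ᵢ ((1 - σᵢ)/4) φᵢ`. -/
theorem trigger_condition_ensures_decrease
    (N : ℕ) (W : Matrix (Fin N) (Fin N) ℝ)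
    (hWnn : ∀ i j, 0 ≤ W i j) (hWdiag : ∀ i, W i i = 0)
    (hbal : ∀ i, ∑ j, W i j = ∑ j, W j i)
    (hd : ∀ i, 0 < ∑ j, W i j)
    (L : Matrix (Fin N) (Fin N) ℝ)
    (hL : L = Matrix.diagonal (fun i => ∑ k, W i k) - W)
    (σ : Fin N → ℝ) (hσ : ∀ i, σ i ∈ Set.Ioo (0 : ℝ) 1)
    (xhat e : Fin N → ℝ)
    (htrig : ∀ i, (e i)^2 ≤
      σ i / (4 * ∑ j, W i j) * ∑ j, W i j * (xhat i - xhat j)^2) :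
    -(xhat ⬝ᵥ L.mulVec xhat) + e ⬝ᵥ L.mulVec xhat
      ≤ -∑ i, (1 - σ i) / 4 * ∑ j, W i j * (xhat i - xhat j)^2 := by
  subst hL
  simp only [dotProduct, laplacian_mulVec_apply]
  rw [sum_mul_sum_sub_of_balanced W hbal, Finset.mul_sum, ← Finset.sum_neg_distrib,
    ← Finset.sum_neg_distrib, ← Finset.sum_add_distrib]
  refine Finset.sum_le_sum fun i _ => ?_
  have hyoung := mul_sum_mul_le_sum_mul_sq_add (W i) (fun j => xhat i - xhat j) (hWnn i) (e i)
  have herr : (∑ j, W i j) * e i ^ 2 ≤ σ i / 4 * ∑ j, W i j * (xhat i - xhat j) ^ 2 := by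
    refine (mul_le_mul_of_nonneg_left (htrig i) (hd i).le).trans_eq ?_
    have := (hd i).ne'
    field_simp
  linarith
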